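/- Let n be even and work on the doubled n-qubit space (ℂ²⊗ℂ²)^{⊗n}. Let ℳ_{i,j} denote the two-qubit twirl on qubits i,j: ℳ_{i,j}(O) = ∫ (V⊗V) O (V⊗V)† dV with V Haar on U(4) acting on qubits i and j (doubled). Define the layer map T = (1/n!) Σ_{P ∈ S_n} P ∘ ℳ_{n−1,n} ∘ ⋯ ∘ ℳ_{1,2}, where P permutes the n doubled factors. Then for every 0 ≤ S ≤ n, T(|S⟩) = Σ_{S'=0}^{n} M_{S',S} |S'⟩, where M_{S',S} = C(n,S)^{−1} Σ_{n₀+n₁+n₂=n/2} 2^{n₁} (n/2)!/(n₀! n₁! n₂!) · [S = n₁ + 2n₂] · Σ_{a+b=n₁} C(n₁, a) (4/5)^a (1/5)^b · [S' = 2b + 2n₂], with [·] the indicator. -/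

import Mathlib

open Matrix Kronecker MeasureTheory

noncomputable section

/-- The swap operator `𝒮` on `ℂ² ⊗ ℂ²`, `𝒮(u ⊗ v) = v ⊗ u`. -/
def swapOp : Matrix (Fin 2 × Fin 2) (Fin 2 × Fin 2) ℂ :=
  Matrix.of fun p q => if p.1 = q.2 ∧ p.2 = q.1 then 1 else 0

/-- The single-site operators `O_0 = I/4` and `O_1 = 𝒮/2` on a doubled qubit. -/
noncomputable def O01 (b : Fin 2) : Matrix (Fin 2 × Fin 2) (Fin 2 × Fin 2) ℂ :=
  if b = 0 then (4 : ℂ)⁻¹ • 1 else (2 : ℂ)⁻¹ • swapOp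

/-- Tensor product over the sites of single-site operators on the doubled space. -/
def tensorSites {ι : Type*} [Fintype ι]
    (f : ι → Matrix (Fin 2 × Fin 2) (Fin 2 × Fin 2) ℂ) :
    Matrix (ι → Fin 2 × Fin 2) (ι → Fin 2 × Fin 2) ℂ :=
  Matrix.of fun x y => ∏ i, f i (x i) (y i)

/-- The symmetrized basis operator
`|S⟩ = C(n,S)⁻¹ ∑_{|σ| = S} ⊗ᵢ O_{σᵢ}` on the doubled space. -/
noncomputable def basisS {ι : Type*} [Fintype ι] [DecidableEq ι] (S : ℕ) :
    Matrix (ι → Fin 2 × Fin 2) (ι → Fin 2 × Fin 2) ℂ :=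
  (((Fintype.card ι).choose S : ℂ))⁻¹ •
    ∑ σ ∈ Finset.univ.filter
        (fun σ : ι → Fin 2 => (Finset.univ.filter fun i => σ i = 1).card = S),
      tensorSites fun i => O01 (σ i)

/-- `𝕊 = 𝒮^{⊗n}`: the two-copy swap applied to every site. -/
def fullSwapSites (ι : Type*) [Fintype ι] :
    Matrix (ι → Fin 2 × Fin 2) (ι → Fin 2 × Fin 2) ℂ :=
  tensorSites fun _ => swapOp

instance matrixMeasurableSpace {m n : Type*} : MeasurableSpace (Matrix m n ℂ) :=
  inferInstanceAs (MeasurableSpace (m → n → ℂ))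

/-- `μ` is a (left-invariant) Haar probability measure on a group of unitaries. -/
def IsHaarProb {G : Type*} [Group G] [MeasurableSpace G] (μ : MeasureTheory.Measure G) : Prop :=
  MeasureTheory.IsProbabilityMeasure μ ∧
    ∀ (g : G) (s : Set G), MeasurableSet s → μ ((g * ·) ⁻¹' s) = μ s

/-- The unitary group `U(2)` acting on one qubit. -/
abbrev U2 := Matrix.unitaryGroup (Fin 2) ℂ

/-- Entrywise Bochner integral of the single-qubit twirl
`V ↦ (V ⊗ V) O (V ⊗ V)†` over `μ`. -/
noncomputable def twirlAvg (μ : MeasureTheory.Measure U2)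
    (O : Matrix (Fin 2 × Fin 2) (Fin 2 × Fin 2) ℂ) :
    Matrix (Fin 2 × Fin 2) (Fin 2 × Fin 2) ℂ :=
  Matrix.of fun p q =>
    ∫ V : U2,
      ((((V : Matrix (Fin 2) (Fin 2) ℂ) ⊗ₖ (V : Matrix (Fin 2) (Fin 2) ℂ)) * O *
        (((V : Matrix (Fin 2) (Fin 2) ℂ) ⊗ₖ (V : Matrix (Fin 2) (Fin 2) ℂ))ᴴ)) p q) ∂μ

/-- The unitary group `U(4)` acting on two qubits (`ℂ² ⊗ ℂ²`). -/
abbrev U4 := Matrix.unitaryGroup (Fin 2 × Fin 2) ℂ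

/-- `V ⊗ V` for a two-qubit unitary `V`, with the doubled four-qubit space reordered
qubit-wise: the first factor carries (copy 1, copy 2) of qubit 1 and the second factor
carries (copy 1, copy 2) of qubit 2. -/
def doubled2 (V : Matrix (Fin 2 × Fin 2) (Fin 2 × Fin 2) ℂ) :
    Matrix ((Fin 2 × Fin 2) × (Fin 2 × Fin 2)) ((Fin 2 × Fin 2) × (Fin 2 × Fin 2)) ℂ :=
  Matrix.of fun p q =>
    V (p.1.1, p.2.1) (q.1.1, q.2.1) * V (p.1.2, p.2.2) (q.1.2, q.2.2)

/-- Entrywise Bochner integral of the two-qubit twirl `V ↦ (V⊗V) O (V⊗V)†` over `μ`,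
in the qubit-wise ordering of the doubled space. -/
noncomputable def twirl4Avg (μ : MeasureTheory.Measure U4)
    (O : Matrix ((Fin 2 × Fin 2) × (Fin 2 × Fin 2)) ((Fin 2 × Fin 2) × (Fin 2 × Fin 2)) ℂ) :
    Matrix ((Fin 2 × Fin 2) × (Fin 2 × Fin 2)) ((Fin 2 × Fin 2) × (Fin 2 × Fin 2)) ℂ :=
  Matrix.of fun p q =>
    ∫ V : U4,
      ((doubled2 (V : Matrix (Fin 2 × Fin 2) (Fin 2 × Fin 2) ℂ) * O *
        (doubled2 (V : Matrix (Fin 2 × Fin 2) (Fin 2 × Fin 2) ℂ))ᴴ) p q) ∂μ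

/-- Embed a single-site doubled operator `M` at site `i`, acting as the identity elsewhere. -/
def actAt {ι : Type*} [Fintype ι] [DecidableEq ι] (i : ι)
    (M : Matrix (Fin 2 × Fin 2) (Fin 2 × Fin 2) ℂ) :
    Matrix (ι → Fin 2 × Fin 2) (ι → Fin 2 × Fin 2) ℂ :=
  Matrix.of fun x y =>
    M (x i) (y i) * ∏ l ∈ Finset.univ.filter (· ≠ i), (if x l = y l then (1 : ℂ) else 0)

/-- The single-qubit Haar twirl `ℳᵢ` at site `i` (entrywise Bochner integral). -/
noncomputable def twirlAt {ι : Type*} [Fintype ι] [DecidableEq ι]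
    (μ : MeasureTheory.Measure U2) (i : ι)
    (O : Matrix (ι → Fin 2 × Fin 2) (ι → Fin 2 × Fin 2) ℂ) :
    Matrix (ι → Fin 2 × Fin 2) (ι → Fin 2 × Fin 2) ℂ :=
  Matrix.of fun x y =>
    ∫ V : U2,
      ((actAt i ((V : Matrix (Fin 2) (Fin 2) ℂ) ⊗ₖ (V : Matrix (Fin 2) (Fin 2) ℂ)) * O *
        (actAt i ((V : Matrix (Fin 2) (Fin 2) ℂ) ⊗ₖ (V : Matrix (Fin 2) (Fin 2) ℂ)))ᴴ) x y) ∂μ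

/-- Average over all permutations of the sites:
`(1/n!) ∑_{P ∈ S_n} P(O)`, where `P` permutes the tensor factors. -/
noncomputable def permAvg {ι : Type*} [Fintype ι] [DecidableEq ι]
    (O : Matrix (ι → Fin 2 × Fin 2) (ι → Fin 2 × Fin 2) ℂ) :
    Matrix (ι → Fin 2 × Fin 2) (ι → Fin 2 × Fin 2) ℂ :=
  (((Fintype.card ι).factorial : ℂ))⁻¹ •
    ∑ P : Equiv.Perm ι, Matrix.of fun x y => O (x ∘ P) (y ∘ P)

/-- Embed a doubled two-qubit operator `W` on the pair of sites `(q,0), (q,1)`, acting as the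
identity on all other sites.  (The `n = 2m` qubits are indexed by `Fin m × Fin 2`, the pair
`q` consisting of the two sites `(q,0)` and `(q,1)`.) -/
def act2At {m : ℕ} (q : Fin m)
    (W : Matrix ((Fin 2 × Fin 2) × (Fin 2 × Fin 2)) ((Fin 2 × Fin 2) × (Fin 2 × Fin 2)) ℂ) :
    Matrix ((Fin m × Fin 2) → Fin 2 × Fin 2) ((Fin m × Fin 2) → Fin 2 × Fin 2) ℂ :=
  Matrix.of fun x y =>
    W (x (q, 0), x (q, 1)) (y (q, 0), y (q, 1)) *
      ∏ l ∈ Finset.univ.filter (fun l : Fin m × Fin 2 => l.1 ≠ q),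
        (if x l = y l then (1 : ℂ) else 0)

/-- The two-qubit Haar twirl `ℳ_{2q+1,2q+2}` on the pair `q` (entrywise Bochner integral). -/
noncomputable def twirl2At {m : ℕ} (μ : Measure U4) (q : Fin m)
    (O : Matrix ((Fin m × Fin 2) → Fin 2 × Fin 2) ((Fin m × Fin 2) → Fin 2 × Fin 2) ℂ) :
    Matrix ((Fin m × Fin 2) → Fin 2 × Fin 2) ((Fin m × Fin 2) → Fin 2 × Fin 2) ℂ :=
  Matrix.of fun x y =>
    ∫ V : U4,
      ((act2At q (doubled2 (V : Matrix (Fin 2 × Fin 2) (Fin 2 × Fin 2) ℂ)) * O *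
        (act2At q (doubled2 (V : Matrix (Fin 2 × Fin 2) (Fin 2 × Fin 2) ℂ)))ᴴ) x y) ∂μ

/-- The layer map `T = (1/n!) ∑_{P} P ∘ ℳ_{n−1,n} ∘ ⋯ ∘ ℳ_{1,2}`: two-qubit twirls on all
pairs followed by the average over site permutations. -/
noncomputable def layerMap {m : ℕ} (μ : Measure U4)
    (O : Matrix ((Fin m × Fin 2) → Fin 2 × Fin 2) ((Fin m × Fin 2) → Fin 2 × Fin 2) ℂ) :
    Matrix ((Fin m × Fin 2) → Fin 2 × Fin 2) ((Fin m × Fin 2) → Fin 2 × Fin 2) ℂ :=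
  permAvg ((List.finRange m).foldl (fun O q => twirl2At μ q O) O)

/-- The transfer-matrix entry
`M_{S',S} = C(n,S)⁻¹ ∑_{n₀+n₁+n₂=n/2} 2^{n₁} (n/2)!/(n₀!n₁!n₂!) [S = n₁+2n₂]
  ∑_{a+b=n₁} C(n₁,a) (4/5)^a (1/5)^b [S' = 2b+2n₂]` for `n = 2m`. -/
noncomputable def Mtransfer (m S' S : ℕ) : ℂ :=
  (((2 * m).choose S : ℂ))⁻¹ *
    ∑ n₁ ∈ Finset.range (m + 1), ∑ n₂ ∈ Finset.range (m + 1),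
      if n₁ + n₂ ≤ m ∧ S = n₁ + 2 * n₂ then
        (2 : ℂ) ^ n₁ *
          ((m.factorial : ℂ) /
            (((m - n₁ - n₂).factorial : ℂ) * (n₁.factorial : ℂ) * (n₂.factorial : ℂ))) *
          ∑ a ∈ Finset.range (n₁ + 1),
            (if S' = 2 * (n₁ - a) + 2 * n₂ then
              (n₁.choose a : ℂ) * (4 / 5 : ℂ) ^ a * (1 / 5 : ℂ) ^ (n₁ - a)
            else 0)
      else 0

theorem commute_kronecker_diagonal_apply {D : Type*} [Fintype D] [DecidableEq D]
    {R : Matrix (D × D) (D × D) ℂ} {u : D → ℂ}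
    (h : Commute (diagonal u ⊗ₖ diagonal u) R) (a b c d : D) :
    u a * u b * R (a, b) (c, d) = R (a, b) (c, d) * (u c * u d) := by
  have h' := congrFun (congrFun h.eq (a, b)) (c, d)
  rwa [diagonal_kronecker_diagonal, diagonal_mul, mul_diagonal] at h'

theorem diagonal_mem_unitaryGroup {D : Type*} [Fintype D] [DecidableEq D]
    {u : D → ℂ} (hu : ∀ x, u x * star (u x) = 1) : diagonal u ∈ unitaryGroup D ℂ := by
  rw [mem_unitaryGroup_iff, star_eq_conjTranspose, diagonal_conjTranspose, diagonal_mul_diagonal,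
    ← diagonal_one]
  exact congrArg diagonal (funext hu)

theorem permMatrix_mem_unitaryGroup {D : Type*} [Fintype D] [DecidableEq D]
    (σ : Equiv.Perm D) : (1 : Matrix D D ℂ).submatrix σ id ∈ unitaryGroup D ℂ := by
  rw [mem_unitaryGroup_iff, star_eq_conjTranspose, conjTranspose_submatrix, conjTranspose_one]
  ext i j
  simp [Matrix.mul_apply, one_apply]

theorem phase_reflection_mem_unitaryGroup {D : Type*} [Fintype D] [DecidableEq D] [Nonempty D] :
    (1 + ((Complex.I - 1) / Fintype.card D) • of fun _ _ => 1 : Matrix D D ℂ) ∈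
      unitaryGroup D ℂ := by
  have hn : (Fintype.card D : ℂ) ≠ 0 := by simp
  have hJ : (of fun _ _ => 1 : Matrix D D ℂ) * (of fun _ _ => 1) =
      (Fintype.card D : ℂ) • of fun _ _ => 1 := by
    ext i j
    simp [Matrix.mul_apply]
  have hJs : (of fun _ _ => 1 : Matrix D D ℂ)ᴴ = of fun _ _ => 1 := by
    ext i j
    simp
  rw [mem_unitaryGroup_iff, star_eq_conjTranspose, conjTranspose_add, conjTranspose_smul, hJs,
    conjTranspose_one, add_mul, mul_add, mul_add, one_mul, one_mul, mul_one, smul_mul_smul_comm,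
    hJ, smul_smul, add_assoc, ← add_smul, ← add_smul]
  convert add_zero (1 : Matrix D D ℂ)
  convert zero_smul ℂ _
  simp only [star_div₀, star_sub, star_one, Complex.star_def, Complex.conj_I, Complex.conj_natCast]
  field_simp
  ring_nf
  simp

/-- Schur–Weyl duality for two copies: the commutant of `{W ⊗ W}` is spanned by the identity
and the swap. -/
theorem exists_eq_of_commute_kronecker_self {D : Type*} [Fintype D] [DecidableEq D] [Nontrivial D]
    (R : Matrix (D × D) (D × D) ℂ)
    (hR : ∀ W ∈ unitaryGroup D ℂ, Commute (W ⊗ₖ W) R) :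
    ∃ α β : ℂ, ∀ a b c d, R (a, b) (c, d) =
      α * (if a = c ∧ b = d then 1 else 0) + β * (if a = d ∧ b = c then 1 else 0) := by
  have hzero : ∀ a b c d, ¬(a = c ∧ b = d) → ¬(a = d ∧ b = c) → R (a, b) (c, d) = 0 := by
    intro a b c d h₁ h₂
    have key : ∀ t : D, ((if a = t then Complex.I else 1) * (if b = t then Complex.I else 1) -
        (if c = t then Complex.I else 1) * (if d = t then Complex.I else 1)) *
        R (a, b) (c, d) = 0 := by
      intro t
      have hu : diagonal (fun x => if x = t then Complex.I else 1) ∈ unitaryGroup D ℂ :=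
        diagonal_mem_unitaryGroup fun x => by split_ifs <;> simp
      linear_combination commute_kronecker_diagonal_apply (hR _ hu) a b c d
    have hI₁ : Complex.I - 1 ≠ 0 := fun h => by simpa using congrArg Complex.im h
    have hI₂ : 1 - Complex.I ≠ 0 := fun h => by simpa using congrArg Complex.im h
    have hI₃ : Complex.I * Complex.I - 1 ≠ 0 := by norm_num
    have hI₄ : Complex.I * Complex.I - Complex.I ≠ 0 :=
      fun h => by simpa using congrArg Complex.im h
    by_contra h0
    have ka := (mul_eq_zero.1 (key a)).resolve_right h0
    have kb := (mul_eq_zero.1 (key b)).resolve_right h0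
    split_ifs at ka kb <;> grind
  have hperm : ∀ (σ : Equiv.Perm D) a b c d,
      R (σ a, σ b) (σ c, σ d) = R (a, b) (c, d) := by
    intro σ a b c d
    have h := congrFun (congrFun (hR _ (permMatrix_mem_unitaryGroup σ)).eq (a, b)) (σ c, σ d)
    simpa [Matrix.mul_apply, Fintype.sum_prod_type, one_apply, ite_and] using h
  have hmix : ∀ a b, a ≠ b →
      R (a, a) (a, a) = R (a, b) (a, b) + R (b, a) (a, b) := by
    intro a b hab
    have hn : (Fintype.card D : ℂ) ≠ 0 := by simp
    set W : Matrix D D ℂ := 1 + ((Complex.I - 1) / Fintype.card D) • of fun _ _ => 1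
    have hWab : W a b ≠ 0 := by
      simp only [W, Matrix.add_apply, one_apply_ne hab, Matrix.smul_apply, of_apply, smul_eq_mul]
      intro h
      field_simp at h
      simpa using congrArg Complex.im h
    have hWaa : W a a ≠ 0 := by
      simp only [W, Matrix.add_apply, one_apply_eq, Matrix.smul_apply, of_apply, smul_eq_mul]
      intro h
      field_simp at h
      simpa using congrArg Complex.im h
    have h := congrFun (congrFun (hR _ phase_reflection_mem_unitaryGroup).eq (a, a)) (a, b)
    change (W ⊗ₖ W * R) (a, a) (a, b) = (R * W ⊗ₖ W) (a, a) (a, b) at h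
    rw [Matrix.mul_apply, Matrix.mul_apply,
      ← Finset.sum_subset (Finset.subset_univ {(a, b), (b, a)}) ?_,
      Finset.sum_pair (by simp [hab]), Finset.sum_eq_single (a, a) ?_ (by simp)] at h
    · simp only [kroneckerMap_apply] at h
      refine mul_left_cancel₀ (mul_ne_zero hWaa hWab) ?_
      linear_combination -h
    · rintro ⟨x, y⟩ - hxy
      rw [hzero a a x y (by grind) (by grind), zero_mul]
    · rintro ⟨x, y⟩ - hxy
      rw [hzero x y a b (by grind) (by grind), mul_zero]
  have htrans : ∀ a b c d : D, a ≠ b → c ≠ d → ∃ σ : Equiv.Perm D, σ a = c ∧ σ b = d := by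
    intro a b c d hab hcd
    refine ⟨Equiv.swap (Equiv.swap a c b) d * Equiv.swap a c, ?_, by simp⟩
    rw [Equiv.Perm.mul_apply, Equiv.swap_apply_left, Equiv.swap_apply_of_ne_of_ne _ hcd]
    intro h
    exact hab ((Equiv.swap a c).injective (by rw [← h, Equiv.swap_apply_left]))
  obtain ⟨a₀, b₀, h₀⟩ := exists_pair_ne D
  have hα : ∀ a b, a ≠ b → R (a, b) (a, b) = R (a₀, b₀) (a₀, b₀) := by
    intro a b hab
    obtain ⟨σ, rfl, rfl⟩ := htrans a₀ b₀ a b h₀ hab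
    exact hperm ..
  have hβ : ∀ a b, a ≠ b → R (b, a) (a, b) = R (b₀, a₀) (a₀, b₀) := by
    intro a b hab
    obtain ⟨σ, rfl, rfl⟩ := htrans a₀ b₀ a b h₀ hab
    exact hperm ..
  refine ⟨R (a₀, b₀) (a₀, b₀), R (b₀, a₀) (a₀, b₀), fun a b c d => ?_⟩
  by_cases h₁ : a = c ∧ b = d
  · obtain ⟨rfl, rfl⟩ := h₁
    by_cases hab : a = b
    · subst hab
      obtain ⟨b', hb'⟩ := exists_ne a
      simp [hmix a b' hb'.symm, hα a b' hb'.symm, hβ a b' hb'.symm]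
    · simp [hab, hα a b hab]
  · by_cases h₂ : a = d ∧ b = c
    · obtain ⟨rfl, rfl⟩ := h₂
      have hab : b ≠ a := fun h => h₁ ⟨h.symm, h⟩
      simp [hab, hβ b a hab, hab.symm]
    · simp [h₁, h₂, hzero a b c d h₁ h₂]

section Twirl

variable {Ω ι : Type*} [MeasurableSpace Ω] {μ : Measure Ω} [Fintype ι]

theorem memLp_top_conj_apply {A : Ω → Matrix ι ι ℂ}
    (hA : ∀ i j, MemLp (fun V => A V i j) ⊤ μ) (O : Matrix ι ι ℂ) [IsFiniteMeasure μ] (x y : ι) :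
    MemLp (fun V => (A V * O * (A V)ᴴ) x y) ⊤ μ := by
  simp only [Matrix.mul_apply, conjTranspose_apply]
  refine memLp_finsetSum _ fun j _ => MemLp.mul' (p := ⊤) (q := ⊤) (hA y j).star
    (memLp_finsetSum _ fun i _ => MemLp.mul' (p := ⊤) (q := ⊤) (memLp_const _) (hA x i))

theorem isLinearMap_integral_conj {A : Ω → Matrix ι ι ℂ} [IsFiniteMeasure μ]
    (hA : ∀ i j, MemLp (fun V => A V i j) ⊤ μ) :
    IsLinearMap ℂ fun O : Matrix ι ι ℂ =>
      (of fun x y => ∫ V, (A V * O * (A V)ᴴ) x y ∂μ : Matrix ι ι ℂ) where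
  map_add O O' := by
    ext x y
    simp only [mul_add, add_mul, Matrix.add_apply, of_apply]
    exact integral_add ((memLp_top_conj_apply hA O x y).integrable le_top)
      ((memLp_top_conj_apply hA O' x y).integrable le_top)
  map_smul c O := by
    ext x y
    simp only [Matrix.mul_smul, Matrix.smul_mul, Matrix.smul_apply, of_apply]
    exact integral_const_mul _ _

theorem mul_integral_mul_apply {F : Ω → Matrix ι ι ℂ}
    (hF : ∀ x y, Integrable (fun V => F V x y) μ) (B C : Matrix ι ι ℂ) (x y : ι) :
    (B * (of fun x y => ∫ V, F V x y ∂μ) * C) x y = ∫ V, (B * F V * C) x y ∂μ := by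
  simp only [Matrix.mul_apply, of_apply]
  rw [integral_finsetSum _ fun j _ => (integrable_finsetSum _ fun i _ =>
    (hF i j).const_mul _).mul_const _]
  refine Finset.sum_congr rfl fun j _ => ?_
  rw [integral_mul_const, integral_finsetSum _ fun i _ => (hF i j).const_mul _]
  simp only [integral_const_mul]

theorem trace_mul_integral {F : Ω → Matrix ι ι ℂ}
    (hF : ∀ x y, Integrable (fun V => F V x y) μ) (B : Matrix ι ι ℂ) :
    (B * (of fun x y => ∫ V, F V x y ∂μ)).trace = ∫ V, (B * F V).trace ∂μ := by
  simp only [Matrix.trace, diag_apply, Matrix.mul_apply, of_apply]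
  rw [integral_finsetSum _ (f := fun i V => ∑ j, B i j * F V j i)
    fun i _ => integrable_finsetSum _ fun j _ => (hF j i).const_mul _]
  refine Finset.sum_congr rfl fun i _ => ?_
  rw [integral_finsetSum _ fun j _ => (hF j i).const_mul _]
  simp only [integral_const_mul]

end Twirl

theorem measurable_unitary_apply (i j : Fin 2 × Fin 2) :
    Measurable fun V : U4 => (V : Matrix (Fin 2 × Fin 2) (Fin 2 × Fin 2) ℂ) i j :=
  (measurable_pi_apply j).comp ((measurable_pi_apply i).comp measurable_subtype_coe)

theorem measurable_unitary_mul_left (W : U4) : Measurable fun V : U4 => W * V := by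
  refine Measurable.subtype_mk (measurable_pi_lambda _ fun i => measurable_pi_lambda _ fun j => ?_)
  change Measurable fun V : U4 => (W.1 * V.1) i j
  simp only [Matrix.mul_apply]
  exact Finset.measurable_sum _ fun k _ => (measurable_unitary_apply k j).const_mul _

theorem IsHaarProb.integral_mul_left {μ : Measure U4} (hμ : IsHaarProb μ) (W : U4)
    {f : U4 → ℂ} (hf : Measurable f) : ∫ V, f (W * V) ∂μ = ∫ V, f V ∂μ := by
  have hm := measurable_unitary_mul_left W
  have hmap : μ.map (W * ·) = μ := by
    ext s hs
    rw [Measure.map_apply hm hs, hμ.2 W s hs]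
  conv_rhs => rw [← hmap]
  exact (integral_map hm.aemeasurable hf.aestronglyMeasurable).symm

theorem doubled2_eq_submatrix (V : Matrix (Fin 2 × Fin 2) (Fin 2 × Fin 2) ℂ) :
    doubled2 V = (V ⊗ₖ V).submatrix (Equiv.prodProdProdComm _ _ _ _)
      (Equiv.prodProdProdComm _ _ _ _) := rfl

theorem doubled2_mul (V W : Matrix (Fin 2 × Fin 2) (Fin 2 × Fin 2) ℂ) :
    doubled2 (V * W) = doubled2 V * doubled2 W := by
  simp only [doubled2_eq_submatrix, submatrix_mul_equiv, mul_kronecker_mul]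

theorem doubled2_conjTranspose (V : Matrix (Fin 2 × Fin 2) (Fin 2 × Fin 2) ℂ) :
    (doubled2 V)ᴴ = doubled2 Vᴴ := by
  simp only [doubled2_eq_submatrix, conjTranspose_submatrix, conjTranspose_kronecker]

theorem doubled2_one : doubled2 1 = 1 := by
  simp only [doubled2_eq_submatrix, one_kronecker_one, submatrix_one_equiv]

theorem doubled2_conjTranspose_mul_self (V : U4) :
    (doubled2 (V : Matrix (Fin 2 × Fin 2) (Fin 2 × Fin 2) ℂ))ᴴ *
      doubled2 (V : Matrix (Fin 2 × Fin 2) (Fin 2 × Fin 2) ℂ) = 1 := by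
  rw [doubled2_conjTranspose, ← doubled2_mul, ← star_eq_conjTranspose, V.2.1, doubled2_one]

theorem doubled2_mul_conjTranspose_self (V : U4) :
    doubled2 (V : Matrix (Fin 2 × Fin 2) (Fin 2 × Fin 2) ℂ) *
      (doubled2 (V : Matrix (Fin 2 × Fin 2) (Fin 2 × Fin 2) ℂ))ᴴ = 1 :=
  mul_eq_one_comm.1 (doubled2_conjTranspose_mul_self V)

theorem measurable_doubled2_apply (p q : (Fin 2 × Fin 2) × (Fin 2 × Fin 2)) :
    Measurable fun V : U4 => doubled2 (V : Matrix (Fin 2 × Fin 2) (Fin 2 × Fin 2) ℂ) p q :=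
  (measurable_unitary_apply _ _).mul (measurable_unitary_apply _ _)

theorem memLp_top_doubled2_apply (μ : Measure U4) (p q : (Fin 2 × Fin 2) × (Fin 2 × Fin 2)) :
    MemLp (fun V : U4 => doubled2 (V : Matrix (Fin 2 × Fin 2) (Fin 2 × Fin 2) ℂ) p q) ⊤ μ := by
  refine memLp_top_of_bound (measurable_doubled2_apply p q).aestronglyMeasurable 1
    (Filter.Eventually.of_forall fun V => ?_)
  simp only [doubled2, of_apply, norm_mul]
  exact mul_le_one₀ (entry_norm_bound_of_unitary V.2 _ _) (norm_nonneg _)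
    (entry_norm_bound_of_unitary V.2 _ _)

section

variable {μ : Measure U4}
  (X K : Matrix ((Fin 2 × Fin 2) × (Fin 2 × Fin 2)) ((Fin 2 × Fin 2) × (Fin 2 × Fin 2)) ℂ)

theorem IsHaarProb.commute_doubled2_twirl4Avg (hμ : IsHaarProb μ) (W : U4) :
    Commute (doubled2 (W : Matrix (Fin 2 × Fin 2) (Fin 2 × Fin 2) ℂ)) (twirl4Avg μ X) := by
  have := hμ.1
  have hconj : doubled2 (W : Matrix (Fin 2 × Fin 2) (Fin 2 × Fin 2) ℂ) * twirl4Avg μ X *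
      (doubled2 (W : Matrix (Fin 2 × Fin 2) (Fin 2 × Fin 2) ℂ))ᴴ = twirl4Avg μ X := by
    ext p q
    rw [twirl4Avg, mul_integral_mul_apply fun x y =>
      (memLp_top_conj_apply (memLp_top_doubled2_apply μ) X x y).integrable le_top]
    refine Eq.trans ?_ (hμ.integral_mul_left W (f := fun V =>
      (doubled2 V.1 * X * (doubled2 V.1)ᴴ) p q) ?_)
    · simp only [Submonoid.coe_mul, doubled2_mul, conjTranspose_mul, Matrix.mul_assoc]
    · simp only [Matrix.mul_apply, conjTranspose_apply]
      exact Finset.measurable_sum _ fun j _ => (Finset.measurable_sum _ fun i _ =>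
        (measurable_doubled2_apply p i).mul_const _).mul (continuous_star.measurable.comp (measurable_doubled2_apply q j))
  rw [commute_iff_eq]
  conv_rhs => rw [← hconj]
  rw [Matrix.mul_assoc, doubled2_conjTranspose_mul_self, Matrix.mul_one]

variable {X K}

theorem trace_mul_twirl4Avg [IsProbabilityMeasure μ]
    (hK : ∀ V : U4, Commute (doubled2 (V : Matrix (Fin 2 × Fin 2) (Fin 2 × Fin 2) ℂ)) K) :
    (K * twirl4Avg μ X).trace = (K * X).trace := by
  rw [twirl4Avg, trace_mul_integral fun x y =>
      (memLp_top_conj_apply (memLp_top_doubled2_apply μ) X x y).integrable le_top]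
  have h : ∀ V : U4, (K * (doubled2 (V : Matrix (Fin 2 × Fin 2) (Fin 2 × Fin 2) ℂ) * X *
      (doubled2 (V : Matrix (Fin 2 × Fin 2) (Fin 2 × Fin 2) ℂ))ᴴ)).trace = (K * X).trace := by
    intro V
    rw [← Matrix.mul_assoc, ← Matrix.mul_assoc, ← (hK V).eq, trace_mul_comm, ← Matrix.mul_assoc,
      ← Matrix.mul_assoc, doubled2_conjTranspose_mul_self, Matrix.one_mul]
  simp [h]

theorem twirl4Avg_eq_self [IsProbabilityMeasure μ]
    (hX : ∀ V : U4, Commute (doubled2 (V : Matrix (Fin 2 × Fin 2) (Fin 2 × Fin 2) ℂ)) X) :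
    twirl4Avg μ X = X := by
  ext p q
  simp [twirl4Avg, (hX _).eq, Matrix.mul_assoc, doubled2_mul_conjTranspose_self]

end

theorem commute_doubled2_swapOp_kronecker (V : Matrix (Fin 2 × Fin 2) (Fin 2 × Fin 2) ℂ) :
    Commute (doubled2 V) (swapOp ⊗ₖ swapOp) := by
  ext ⟨⟨a, b⟩, c, d⟩ ⟨⟨a', b'⟩, c', d'⟩
  simp [Matrix.mul_apply, Fintype.sum_prod_type, swapOp, doubled2, ite_and]
  ring

theorem swapOp_mul_swapOp : swapOp * swapOp = 1 := by
  ext ⟨a, b⟩ ⟨c, d⟩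
  simp [Matrix.mul_apply, Fintype.sum_prod_type, swapOp, ite_and, one_apply]

theorem trace_swapOp : swapOp.trace = 2 := by
  simp only [Matrix.trace, diag_apply, swapOp, of_apply, Fintype.sum_prod_type, Fin.sum_univ_two]
  norm_num

theorem IsHaarProb.exists_twirl4Avg_eq {μ : Measure U4} (hμ : IsHaarProb μ)
    (X : Matrix ((Fin 2 × Fin 2) × (Fin 2 × Fin 2)) ((Fin 2 × Fin 2) × (Fin 2 × Fin 2)) ℂ) :
    ∃ α β : ℂ, twirl4Avg μ X = α • 1 + β • (swapOp ⊗ₖ swapOp) := by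
  obtain ⟨α, β, h⟩ := exists_eq_of_commute_kronecker_self
    ((twirl4Avg μ X).submatrix (Equiv.prodProdProdComm _ _ _ _) (Equiv.prodProdProdComm _ _ _ _))
    fun W hW => by
      have h := congrArg (fun M => M.submatrix (Equiv.prodProdProdComm _ _ _ _)
        (Equiv.prodProdProdComm _ _ _ _)) (hμ.commute_doubled2_twirl4Avg X ⟨W, hW⟩).eq
      simp only [← submatrix_mul_equiv _ _ _ (Equiv.prodProdProdComm _ _ _ _) _] at h
      exact h
  refine ⟨α, β, ?_⟩
  ext ⟨⟨a, b⟩, c, d⟩ ⟨⟨a', b'⟩, c', d'⟩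
  have h' := h (a, c) (b, d) (a', c') (b', d')
  simp only [submatrix_apply, Equiv.prodProdProdComm_apply] at h'
  rw [h']
  simp only [Matrix.add_apply, Matrix.smul_apply, one_apply, smul_eq_mul, swapOp,
    kroneckerMap_apply, of_apply, Prod.mk.injEq, ← ite_and, mul_ite, mul_one, mul_zero]
  grind

/-- The coefficient of `O_c ⊗ O_c` in the two-qubit twirl of `O_s ⊗ O_t`. -/
def twirlWeight (s t c : Fin 2) : ℂ :=
  if s = t then (if c = s then 1 else 0) else (if c = 0 then 4 / 5 else 1 / 5)

theorem IsHaarProb.twirl4Avg_O01 {μ : Measure U4} (hμ : IsHaarProb μ) (s t : Fin 2) :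
    twirl4Avg μ (O01 s ⊗ₖ O01 t) = ∑ c, twirlWeight s t c • (O01 c ⊗ₖ O01 c) := by
  have := hμ.1
  have hF := fun V : U4 => commute_doubled2_swapOp_kronecker V.1
  have hmixed : ∀ X : Matrix ((Fin 2 × Fin 2) × (Fin 2 × Fin 2)) _ ℂ, X.trace = 1 →
      ((swapOp ⊗ₖ swapOp) * X).trace = 1 →
      twirl4Avg μ X = (4 / 5 : ℂ) • (O01 0 ⊗ₖ O01 0) + (1 / 5 : ℂ) • (O01 1 ⊗ₖ O01 1) := by
    intro X h₁ h₂
    obtain ⟨α, β, h⟩ := hμ.exists_twirl4Avg_eq X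
    have e₁ := trace_mul_twirl4Avg (μ := μ) (X := X) (K := 1) fun V => Commute.one_right _
    have e₂ := trace_mul_twirl4Avg (μ := μ) (X := X) hF
    rw [h] at e₁ e₂ ⊢
    simp only [Matrix.one_mul, Matrix.mul_add, Matrix.mul_smul, Matrix.mul_one, trace_add,
      trace_smul, trace_kronecker, trace_swapOp, ← mul_kronecker_mul, swapOp_mul_swapOp,
      trace_one, Fintype.card_prod, Fintype.card_fin, h₁, h₂, smul_eq_mul] at e₁ e₂
    norm_num at e₁ e₂
    have hα : α = 1 / 20 := by linear_combination (4 * e₁ - e₂) / 60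
    have hβ : β = 1 / 20 := by linear_combination (4 * e₂ - e₁) / 60
    simp only [O01, hα, hβ, if_true, one_ne_zero, if_false, smul_kronecker, kronecker_smul,
      one_kronecker_one, smul_smul]
    norm_num
  fin_cases s <;> fin_cases t
  · have : twirl4Avg μ (O01 0 ⊗ₖ O01 0) = O01 0 ⊗ₖ O01 0 := twirl4Avg_eq_self fun V => by
      simp only [O01, if_true, smul_kronecker, kronecker_smul, one_kronecker_one]
      exact ((Commute.one_right _).smul_right _).smul_right _
    simpa [twirlWeight] using this
  · have := hmixed (O01 0 ⊗ₖ O01 1) (by simp [O01, trace_kronecker, trace_swapOp])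
      (by simp [O01, trace_kronecker, trace_swapOp, ← mul_kronecker_mul, swapOp_mul_swapOp,
        smul_kronecker, kronecker_smul]; norm_num)
    simpa [twirlWeight] using this
  · have := hmixed (O01 1 ⊗ₖ O01 0) (by simp [O01, trace_kronecker, trace_swapOp])
      (by simp [O01, trace_kronecker, trace_swapOp, ← mul_kronecker_mul, swapOp_mul_swapOp,
        smul_kronecker, kronecker_smul]; norm_num)
    simpa [twirlWeight] using this
  · have : twirl4Avg μ (O01 1 ⊗ₖ O01 1) = O01 1 ⊗ₖ O01 1 := twirl4Avg_eq_self fun V => by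
      simp only [O01, one_ne_zero, if_false, smul_kronecker, kronecker_smul]
      exact ((hF V).smul_right _).smul_right _
    simpa [twirlWeight] using this

section PairProd

variable {m : ℕ}

/-- Group the sites `(q, 0)`, `(q, 1)` of a configuration into pairs. -/
def pairEquiv (m : ℕ) (α : Type*) : (Fin m × Fin 2 → α) ≃ (Fin m → α × α) :=
  (Equiv.curry _ _ _).trans (Equiv.piCongrRight fun _ => finTwoArrowEquiv α)

theorem pairEquiv_apply {α : Type*} (x : Fin m × Fin 2 → α) (q : Fin m) :
    pairEquiv m α x q = (x (q, 0), x (q, 1)) := rfl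

/-- Tensor product over the pairs of doubled two-qubit operators. -/
def pairProd
    (X : Fin m → Matrix ((Fin 2 × Fin 2) × (Fin 2 × Fin 2)) ((Fin 2 × Fin 2) × (Fin 2 × Fin 2)) ℂ) :
    Matrix ((Fin m × Fin 2) → Fin 2 × Fin 2) ((Fin m × Fin 2) → Fin 2 × Fin 2) ℂ :=
  of fun x y => ∏ q, X q (pairEquiv m _ x q) (pairEquiv m _ y q)

variable
  (X Y : Fin m → Matrix ((Fin 2 × Fin 2) × (Fin 2 × Fin 2)) ((Fin 2 × Fin 2) × (Fin 2 × Fin 2)) ℂ)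
  (W : Matrix ((Fin 2 × Fin 2) × (Fin 2 × Fin 2)) ((Fin 2 × Fin 2) × (Fin 2 × Fin 2)) ℂ)
  (q : Fin m)

theorem pairProd_mul : pairProd X * pairProd Y = pairProd fun q => X q * Y q := by
  ext x y
  simp only [pairProd, Matrix.mul_apply, of_apply, Finset.prod_univ_sum, Fintype.piFinset_univ,
    ← Finset.prod_mul_distrib]
  exact (pairEquiv m _).sum_comp fun z =>
    ∏ q, X q (pairEquiv m _ x q) (z q) * Y q (z q) (pairEquiv m _ y q)

theorem pairProd_conjTranspose : (pairProd X)ᴴ = pairProd fun q => (X q)ᴴ := by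
  ext x y
  simp [pairProd]

theorem pairProd_update_apply (x y : Fin m × Fin 2 → Fin 2 × Fin 2) :
    pairProd (Function.update X q W) x y = W (pairEquiv m _ x q) (pairEquiv m _ y q) *
      ∏ q' ∈ Finset.univ.erase q, X q' (pairEquiv m _ x q') (pairEquiv m _ y q') := by
  rw [pairProd, of_apply, ← Finset.mul_prod_erase _ _ (Finset.mem_univ q), Function.update_self]
  congr 1
  exact Finset.prod_congr rfl fun q' hq' => by
    rw [Function.update_of_ne (Finset.ne_of_mem_erase hq')]

theorem act2At_eq_pairProd : act2At q W = pairProd (Function.update 1 q W) := by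
  ext x y
  rw [pairProd_update_apply, act2At, of_apply, Finset.prod_filter, Fintype.prod_prod_type]
  congr 1
  rw [← Finset.mul_prod_erase _ _ (Finset.mem_univ q)]
  simp only [ne_eq, not_true_eq_false, if_false, Finset.prod_const_one, one_mul]
  refine Finset.prod_congr rfl fun q' hq' => ?_
  simp only [Finset.ne_of_mem_erase hq', not_false_eq_true, if_true, Fin.prod_univ_two,
    Pi.one_apply, one_apply, pairEquiv_apply, Prod.mk.injEq, ite_and, ite_mul, one_mul, zero_mul]

theorem act2At_mul_pairProd_mul :
    act2At q W * pairProd X * (act2At q W)ᴴ =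
      pairProd (Function.update X q (W * X q * Wᴴ)) := by
  rw [act2At_eq_pairProd, pairProd_conjTranspose, pairProd_mul, pairProd_mul]
  congr 1
  funext q'
  by_cases h : q' = q
  · subst h
    simp
  · simp [h]

theorem twirl2At_pairProd (μ : Measure U4) :
    twirl2At μ q (pairProd X) = pairProd (Function.update X q (twirl4Avg μ (X q))) := by
  ext x y
  simp only [twirl2At, of_apply, act2At_mul_pairProd_mul, pairProd_update_apply, twirl4Avg]
  exact integral_mul_const _ _

theorem foldl_twirl2At_pairProd (μ : Measure U4) {l : List (Fin m)} (hl : l.Nodup) :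
    l.foldl (fun O q => twirl2At μ q O) (pairProd X) =
      pairProd fun q => if q ∈ l then twirl4Avg μ (X q) else X q := by
  induction l generalizing X with
  | nil => simp
  | cons q l ih =>
    rw [List.nodup_cons] at hl
    rw [List.foldl_cons, twirl2At_pairProd, ih _ hl.2]
    congr 1
    funext q'
    by_cases h : q' = q
    · subst h
      simp [hl.1]
    · simp [h]

theorem isLinearMap_twirl2At (μ : Measure U4) [IsFiniteMeasure μ] :
    IsLinearMap ℂ (twirl2At μ q) :=
  isLinearMap_integral_conj fun x y => by
    simp only [act2At, of_apply]
    exact MemLp.mul' (p := ⊤) (q := ⊤) (memLp_const _) (memLp_top_doubled2_apply μ _ _)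

theorem isLinearMap_foldl_twirl2At (μ : Measure U4) [IsFiniteMeasure μ] (l : List (Fin m)) :
    IsLinearMap ℂ fun O => l.foldl (fun O q => twirl2At μ q O) O := by
  induction l with
  | nil => exact LinearMap.id.isLinear
  | cons q l ih => exact (ih.mk' _ ∘ₗ (isLinearMap_twirl2At q μ).mk' _).isLinear

theorem isLinearMap_permAvg {ι : Type*} [Fintype ι] [DecidableEq ι] :
    IsLinearMap ℂ (permAvg (ι := ι)) where
  map_add O O' := by
    simp only [permAvg, ← smul_add, ← Finset.sum_add_distrib]
    rfl
  map_smul c O := by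
    rw [permAvg, permAvg, smul_comm c, Finset.smul_sum (r := c)]
    rfl

theorem isLinearMap_layerMap (μ : Measure U4) [IsFiniteMeasure μ] :
    IsLinearMap ℂ (layerMap (m := m) μ) :=
  (isLinearMap_permAvg.mk' _ ∘ₗ (isLinearMap_foldl_twirl2At μ (List.finRange m)).mk' _).isLinear

theorem tensorSites_eq_pairProd (f : Fin m × Fin 2 → Matrix (Fin 2 × Fin 2) (Fin 2 × Fin 2) ℂ) :
    tensorSites f = pairProd fun q => f (q, 0) ⊗ₖ f (q, 1) := by
  ext x y
  simp [tensorSites, pairProd, Fintype.prod_prod_type, pairEquiv_apply]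

theorem pairProd_sum_smul {κ : Type*} [Fintype κ] (w : Fin m → κ → ℂ)
    (M : κ → Matrix ((Fin 2 × Fin 2) × (Fin 2 × Fin 2)) ((Fin 2 × Fin 2) × (Fin 2 × Fin 2)) ℂ) :
    pairProd (fun q => ∑ k, w q k • M k) =
      ∑ c : Fin m → κ, (∏ q, w q (c q)) • pairProd fun q => M (c q) := by
  classical
  ext x y
  simp [pairProd, Matrix.sum_apply, Finset.prod_univ_sum, Fintype.piFinset_univ,
    Finset.prod_mul_distrib]

end PairProd

section Symmetrization

variable {ι : Type*} [Fintype ι]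

theorem exists_perm_comp_eq {σ τ : ι → Fin 2}
    (h : (Finset.univ.filter fun i => σ i = 1).card = (Finset.univ.filter fun i => τ i = 1).card) :
    ∃ Q : Equiv.Perm ι, σ ∘ Q = τ := by
  have e : {i // τ i = 1} ≃ {i // σ i = 1} :=
    Fintype.equivOfCardEq (by rw [Fintype.card_subtype, Fintype.card_subtype, h])
  refine ⟨e.extendSubtype, funext fun i => ?_⟩
  by_cases hi : τ i = 1
  · simpa [hi] using e.extendSubtype_mem i hi
  · have := e.extendSubtype_not_mem i hi
    simp only [Function.comp_apply]
    omega

theorem card_filter_comp_perm (σ : ι → Fin 2) (P : Equiv.Perm ι) :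
    (Finset.univ.filter fun i => (σ ∘ P) i = 1).card =
      (Finset.univ.filter fun i => σ i = 1).card := by
  rw [← Fintype.card_subtype, ← Fintype.card_subtype]
  exact Fintype.card_congr (P.subtypeEquiv fun _ => Iff.rfl)

variable [DecidableEq ι]

theorem card_filter_card_eq_one (k : ℕ) :
    (Finset.univ.filter
      fun τ : ι → Fin 2 => (Finset.univ.filter fun i => τ i = 1).card = k).card =
      (Fintype.card ι).choose k := by
  rw [← Finset.card_univ, ← Finset.card_powersetCard]
  refine Finset.card_nbij' (fun τ => Finset.univ.filter fun i => τ i = 1)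
    (fun s i => if i ∈ s then 1 else 0) ?_ ?_ ?_ ?_
  · intro τ hτ
    simpa [Finset.mem_powersetCard] using hτ
  · intro s hs
    simpa [Finset.mem_powersetCard] using hs
  · intro τ _
    funext i
    by_cases h : τ i = 1
    · simp [h]
    · simp only [Finset.mem_filter, h, and_false, if_false]
      omega
  · intro s _
    ext i
    simp

/-- Averaging over permutations equals averaging over the orbit. -/
theorem average_perm_eq_average_orbit {V : Type*} [AddCommGroup V] [Module ℂ V]
    (F : (ι → Fin 2) → V) (σ : ι → Fin 2) :
    ((Fintype.card ι).factorial : ℂ)⁻¹ • ∑ P : Equiv.Perm ι, F (σ ∘ P) =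
      ((Fintype.card ι).choose (Finset.univ.filter fun i => σ i = 1).card : ℂ)⁻¹ •
        ∑ τ ∈ Finset.univ.filter (fun τ : ι → Fin 2 =>
          (Finset.univ.filter fun i => τ i = 1).card =
            (Finset.univ.filter fun i => σ i = 1).card), F τ := by
  set K := Finset.univ.filter (fun τ : ι → Fin 2 =>
    (Finset.univ.filter fun i => τ i = 1).card = (Finset.univ.filter fun i => σ i = 1).card)
    with hK
  have hconst : ∀ τ ∈ K, ∑ P : Equiv.Perm ι, F (τ ∘ P) = ∑ P : Equiv.Perm ι, F (σ ∘ P) := by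
    intro τ hτ
    obtain ⟨Q, rfl⟩ := exists_perm_comp_eq (Finset.mem_filter.1 hτ).2.symm
    exact Fintype.sum_equiv (Equiv.mulLeft Q) _ _ fun P => rfl
  have hinv : ∀ P : Equiv.Perm ι, ∑ τ ∈ K, F (τ ∘ P) = ∑ τ ∈ K, F τ := by
    intro P
    refine Finset.sum_equiv (P.arrowCongr (Equiv.refl _)).symm (fun τ => ?_) fun τ _ => rfl
    simp only [hK, Finset.mem_filter, Finset.mem_univ, true_and]
    rw [← card_filter_comp_perm τ P]
    rfl
  have hdouble : (K.card : ℂ) • ∑ P : Equiv.Perm ι, F (σ ∘ P) =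
      ((Fintype.card ι).factorial : ℂ) • ∑ τ ∈ K, F τ := by
    rw [Nat.cast_smul_eq_nsmul, ← Finset.sum_const, ← Finset.sum_congr rfl hconst,
      Finset.sum_comm, Finset.sum_congr rfl fun P _ => hinv P, Finset.sum_const,
      Finset.card_univ, Fintype.card_perm, Nat.cast_smul_eq_nsmul]
  have hpos : (K.card : ℂ) ≠ 0 := by
    rw [Nat.cast_ne_zero]
    exact Finset.card_ne_zero_of_mem (a := σ) (by simp [hK])
  have hfac : ((Fintype.card ι).factorial : ℂ) ≠ 0 := Nat.cast_ne_zero.2 (Nat.factorial_ne_zero _)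
  rw [← card_filter_card_eq_one, ← hK, inv_smul_eq_iff₀ hfac, smul_comm, ← hdouble,
    inv_smul_smul₀ hpos]

theorem permAvg_tensorSites_O01 (σ : ι → Fin 2) :
    permAvg (tensorSites fun i => O01 (σ i)) =
      basisS (Finset.univ.filter fun i => σ i = 1).card := by
  rw [permAvg, basisS, ← average_perm_eq_average_orbit fun τ => tensorSites fun i => O01 (τ i)]
  refine congrArg _ (Fintype.sum_equiv (Equiv.inv (Equiv.Perm ι)) _ _ fun P => ?_)
  ext x y
  simp only [tensorSites, of_apply]
  exact Fintype.prod_equiv P _ _ fun i => by simp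

end Symmetrization

theorem IsHaarProb.layerMap_tensorSites_O01 {m : ℕ} {μ : Measure U4} (hμ : IsHaarProb μ)
    (σ : Fin m × Fin 2 → Fin 2) :
    layerMap μ (tensorSites fun i => O01 (σ i)) =
      ∑ c : Fin m → Fin 2, (∏ q, twirlWeight (σ (q, 0)) (σ (q, 1)) (c q)) •
        basisS (2 * (Finset.univ.filter fun q => c q = 1).card) := by
  rw [layerMap, tensorSites_eq_pairProd, foldl_twirl2At_pairProd _ _ (List.nodup_finRange m)]
  simp only [List.mem_finRange, if_true, hμ.twirl4Avg_O01]
  rw [pairProd_sum_smul (fun q => twirlWeight (σ (q, 0)) (σ (q, 1))) fun k => O01 k ⊗ₖ O01 k]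
  change isLinearMap_permAvg.mk' _ _ = _
  rw [map_sum]
  refine Finset.sum_congr rfl fun c _ => ?_
  rw [map_smul, ← tensorSites_eq_pairProd fun i => O01 (c i.1), IsLinearMap.mk'_apply,
    permAvg_tensorSites_O01 fun i : Fin m × Fin 2 => c i.1]
  congr 2
  simp only [Finset.card_filter, Fintype.sum_prod_type, Fin.sum_univ_two, ← two_mul,
    Finset.mul_sum]

section GeneratingFunction

open Polynomial

theorem prod_monomial {R κ : Type*} [CommSemiring R] (s : Finset κ) (a : κ → ℕ) (r : κ → R) :
    ∏ q ∈ s, monomial (a q) (r q) = monomial (∑ q ∈ s, a q) (∏ q ∈ s, r q) := by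
  classical
  induction s using Finset.induction_on with
  | empty => simp
  | insert q s hq ih => rw [Finset.prod_insert hq, ih, monomial_mul_monomial,
      Finset.sum_insert hq, Finset.prod_insert hq]

theorem card_filter_eq_one_eq_sum {κ : Type*} [Fintype κ] (σ : κ → Fin 2) :
    (Finset.univ.filter fun i => σ i = 1).card = ∑ i, (σ i : ℕ) := by
  rw [Finset.card_filter]
  refine Finset.sum_congr rfl fun i _ => ?_
  split_ifs <;> omega

theorem sum_pair_configurations_prod {R : Type*} [CommSemiring R] (m : ℕ)
    (g : Fin 2 × Fin 2 → Fin 2 → R) :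
    ∑ σ : Fin m × Fin 2 → Fin 2, ∑ c : Fin m → Fin 2, ∏ q, g (σ (q, 0), σ (q, 1)) (c q) =
      (∑ s, ∑ c, g s c) ^ m := by
  refine (Fintype.sum_equiv (pairEquiv m (Fin 2)) _
    (fun σ => ∑ c : Fin m → Fin 2, ∏ q, g (σ q) (c q)) fun σ => rfl).trans ?_
  have h : (∑ s, ∑ c, g s c) ^ m = ∏ _q : Fin m, ∑ s, ∑ c, g s c := by simp
  simp only [h, Finset.prod_univ_sum, Fintype.piFinset_univ]

theorem add_add_pow_eq_sum {R : Type*} [CommRing R] [Algebra ℂ R] (A B : R) (m : ℕ) :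
    (1 + A + B) ^ m = ∑ n₁ ∈ Finset.range (m + 1), ∑ n₂ ∈ Finset.range (m + 1),
      if n₁ + n₂ ≤ m then ((m.factorial : ℂ) /
        (((m - n₁ - n₂).factorial : ℂ) * (n₁.factorial : ℂ) * (n₂.factorial : ℂ))) •
          (A ^ n₁ * B ^ n₂) else 0 := by
  rw [show 1 + A + B = A + (B + 1) by ring, add_pow]
  refine Finset.sum_congr rfl fun n₁ h₁ => ?_
  rw [Finset.mem_range, Nat.lt_succ_iff] at h₁
  rw [← Finset.sum_filter, add_pow, Finset.mul_sum, Finset.sum_mul]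
  have hr : (Finset.range (m + 1)).filter (fun n₂ => n₁ + n₂ ≤ m) =
      Finset.range (m - n₁ + 1) := by
    ext n₂
    simp only [Finset.mem_filter, Finset.mem_range]
    omega
  rw [hr]
  refine Finset.sum_congr rfl fun n₂ h₂ => ?_
  rw [Finset.mem_range, Nat.lt_succ_iff] at h₂
  have hc : (m.factorial : ℂ) /
      (((m - n₁ - n₂).factorial : ℂ) * (n₁.factorial : ℂ) * (n₂.factorial : ℂ)) =
      ((m - n₁).choose n₂ * m.choose n₁ : ℕ) := by
    have f := fun k : ℕ => (Nat.cast_ne_zero (R := ℂ)).2 (Nat.factorial_ne_zero k)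
    have := f (m - n₁)
    have := f n₁
    have := f n₂
    have := f (m - n₁ - n₂)
    rw [Nat.cast_mul, Nat.cast_choose ℂ h₁, Nat.cast_choose ℂ h₂]
    field_simp
  rw [hc, Nat.cast_smul_eq_nsmul, nsmul_eq_mul]
  push_cast
  ring

/-- The transfer matrix as a sum over configurations `σ` of the sites before, and `c` of the pairs
after, the layer of twirls. -/
theorem Mtransfer_eq_sum (m S' S : ℕ) :
    Mtransfer m S' S = ((2 * m).choose S : ℂ)⁻¹ *
      ∑ σ ∈ Finset.univ.filter (fun σ : Fin m × Fin 2 → Fin 2 =>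
        (Finset.univ.filter fun i => σ i = 1).card = S),
        ∑ c : Fin m → Fin 2, if 2 * (Finset.univ.filter fun q => c q = 1).card = S' then
          ∏ q, twirlWeight (σ (q, 0)) (σ (q, 1)) (c q) else 0 := by
  let g : Fin 2 × Fin 2 → Fin 2 → ℂ[X][X] := fun s c =>
    monomial (s.1 + s.2 : ℕ) (monomial (2 * c : ℕ) (twirlWeight s.1 s.2 c))
  have hg : ∑ s, ∑ c, g s c = 1 + monomial 1 (monomial 0 (8 / 5) + monomial 2 (2 / 5)) +
      monomial 2 (monomial 2 1) := by
    simp only [g, Fintype.sum_prod_type, Fin.sum_univ_two, twirlWeight]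
    simp only [Fin.isValue, Fin.val_zero, Fin.val_one, if_true, one_ne_zero, zero_ne_one,
      if_false, map_zero, add_zero, zero_add, mul_zero, mul_one, Nat.reduceAdd]
    rw [show (8 / 5 : ℂ) = 4 / 5 + 4 / 5 by norm_num, show (2 / 5 : ℂ) = 1 / 5 + 1 / 5 by norm_num]
    simp only [map_add, monomial_zero_one]
    ring
  have hpow := sum_pair_configurations_prod m g
  rw [hg, add_add_pow_eq_sum] at hpow
  have hcoeff := congrArg (fun p : ℂ[X][X] => (p.coeff S).coeff S') hpow
  rw [Mtransfer, Finset.sum_filter]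
  congr 1
  refine Eq.trans ?_ (hcoeff.symm.trans ?_)
  · simp only [finsetSum_coeff]
    refine Finset.sum_congr rfl fun n₁ _ => Finset.sum_congr rfl fun n₂ _ => ?_
    by_cases h : n₁ + n₂ ≤ m
    · simp only [h, true_and, if_true, monomial_pow, monomial_mul_monomial, coeff_smul,
        coeff_monomial, one_mul, one_pow]
      by_cases hS : S = n₁ + 2 * n₂
      · rw [if_pos hS, if_pos hS.symm, add_pow, Finset.sum_mul, finsetSum_coeff, mul_comm (_ ^ _),
          mul_assoc, smul_eq_mul, Finset.mul_sum]
        refine congrArg _ (Finset.sum_congr rfl fun a ha => ?_)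
        rw [Finset.mem_range, Nat.lt_succ_iff] at ha
        have h2 : (2 : ℂ) ^ n₁ = 2 ^ a * 2 ^ (n₁ - a) := by rw [← pow_add, Nat.add_sub_cancel' ha]
        rw [monomial_pow, monomial_pow, monomial_mul_monomial,
          mul_right_comm (monomial _ ((8 / 5 : ℂ) ^ a * _)),
          monomial_mul_monomial, coeff_mul_natCast, coeff_monomial, mul_one, zero_mul, zero_add, h2,
          show (8 / 5 : ℂ) = 2 * (4 / 5) by norm_num, show (2 / 5 : ℂ) = 2 * (1 / 5) by norm_num,
          mul_pow, mul_pow]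
        by_cases hS' : S' = 2 * (n₁ - a) + 2 * n₂
        · rw [if_pos hS', if_pos hS'.symm]
          ring
        · rw [if_neg hS', if_neg (Ne.symm hS'), mul_zero, zero_mul]
      · rw [if_neg hS, if_neg (Ne.symm hS), coeff_zero, smul_zero]
    · simp [h]
  · simp only [g, prod_monomial, finsetSum_coeff, coeff_monomial]
    refine Finset.sum_congr rfl fun σ _ => ?_
    rw [card_filter_eq_one_eq_sum, Fintype.sum_prod_type]
    simp only [Fin.sum_univ_two]
    split_ifs with h
    · refine Finset.sum_congr rfl fun c _ => ?_
      rw [coeff_monomial, card_filter_eq_one_eq_sum, Finset.mul_sum]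
    · simp

end GeneratingFunction

/-- For `n = 2m` qubits, a layer of two-qubit Haar twirls on disjoint pairs
followed by a site-permutation average acts on the symmetrized basis as
`T(|S⟩) = ∑_{S'} M_{S',S} |S'⟩`. -/
theorem layer_transfer_matrix
    (m : ℕ) (μ : Measure U4) (hμ : IsHaarProb μ)
    (S : ℕ) (hS : S ≤ 2 * m) :
    layerMap μ (basisS (ι := Fin m × Fin 2) S) =
      ∑ S' ∈ Finset.range (2 * m + 1), Mtransfer m S' S • basisS (ι := Fin m × Fin 2) S' := by
  have := hμ.1
  have hcard : Fintype.card (Fin m × Fin 2) = 2 * m := by simp [mul_comm]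
  have hlin := isLinearMap_layerMap (m := m) μ
  change hlin.mk' _ _ = _
  rw [basisS, hcard, map_smul, map_sum]
  simp only [Mtransfer_eq_sum, mul_smul, IsLinearMap.mk'_apply]
  rw [← Finset.smul_sum]
  simp only [hμ.layerMap_tensorSites_O01, Finset.sum_smul, ite_smul, zero_smul]
  refine congrArg _ ?_
  conv_rhs => rw [Finset.sum_comm]
  refine Finset.sum_congr rfl fun σ _ => ?_
  conv_rhs => rw [Finset.sum_comm]
  refine Finset.sum_congr rfl fun c _ => ?_
  have hc : (Finset.univ.filter fun q => c q = 1).card ≤ m :=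
    (Finset.card_le_univ _).trans_eq (Fintype.card_fin m)
  rw [Finset.sum_ite_eq, if_pos (Finset.mem_range.2 (by omega))]
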